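/- Let Z_k = {z_1,…,z_k} be a separating subset of a finite poset P with P^≺ = {t} a single element. Then G(P) = −Δ_{Z_k}[(t − z)^{k−1} G(P^≻ ∪ z)]/h(t) = −Σ_{j=1}^k (t − z_j)^{k−1} G(P^≻ ∪ z_j)/(h(t) h′(z_j)), where h(z) = ∏_{i=1}^k (z − z_i). -/

import Mathlib

open scoped Classical

noncomputable section

/-- The position `m` (as an element of `Fin n`) for `m : Fin (n-1)`. -/
def idxLo {n : ℕ} (m : Fin (n - 1)) : Fin n := ⟨m.1, by have := m.2; omega⟩

/-- The position `m+1` (as an element of `Fin n`) for `m : Fin (n-1)`. -/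
def idxHi {n : ℕ} (m : Fin (n - 1)) : Fin n := ⟨m.1 + 1, by have := m.2; omega⟩

/-- The Greene sum of a finite poset, given by a strict order relation `r`
(`r u v` means `u ≺ v`) on a finite index type `ι`, with variables `x : ι → K`:
the sum over all linear extensions (words listing the elements from maximal to
minimal) of the product of the inverses of consecutive differences. -/
def greeneSum {ι : Type*} [Fintype ι] {K : Type*} [Field K]
    (r : ι → ι → Prop) (x : ι → K) : K :=
  ∑ α : Equiv.Perm (Fin (Fintype.card ι)),
    if ∀ i j : Fin (Fintype.card ι),
        r ((Fintype.equivFin ι).symm (α i)) ((Fintype.equivFin ι).symm (α j)) → j < i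
    then ∏ m : Fin (Fintype.card ι - 1),
        (x ((Fintype.equivFin ι).symm (α (idxLo m))) -
          x ((Fintype.equivFin ι).symm (α (idxHi m))))⁻¹
    else 0

/-- `Z` is a separating subset of the poset `(ι, r)`: elements of `Z` are pairwise
incomparable and every element outside `Z` is either below every element of `Z` or
above every element of `Z`. -/
def IsSeparating {ι : Type*} (r : ι → ι → Prop) (Z : Set ι) : Prop :=
  (∀ a ∈ Z, ∀ b ∈ Z, a ≠ b → ¬ r a b ∧ ¬ r b a) ∧
  ∀ u ∉ Z, (∀ a ∈ Z, r u a) ∨ (∀ a ∈ Z, r a u)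

/-- `P^≺`: the set of elements lying below every element of `Z`. -/
def below {ι : Type*} (r : ι → ι → Prop) (Z : Set ι) : Set ι := {u | ∀ a ∈ Z, r u a}

/-- `P^≻`: the set of elements lying above every element of `Z`. -/
def above {ι : Type*} (r : ι → ι → Prop) (Z : Set ι) : Set ι := {u | ∀ a ∈ Z, r a u}

/-- Adjoin a new minimum (the element `none`) to a poset. -/
def adjoinMin {ι : Type*} (r : ι → ι → Prop) : Option ι → Option ι → Prop
  | none, some _ => True
  | some a, some b => r a b
  | _, _ => False

/-- Adjoin a new maximum (the element `none`) to a poset. -/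
def adjoinMax {ι : Type*} (r : ι → ι → Prop) : Option ι → Option ι → Prop
  | some _, none => True
  | some a, some b => r a b
  | _, _ => False

/-- Extend variables `x : ι → K` to `Option ι` by assigning the value `z` to the
adjoined element `none`. -/
def extendVar {ι K : Type*} (x : ι → K) (z : K) : Option ι → K
  | none => z
  | some a => x a

/-- The Newton divided difference `Δ_{Z_k}[φ]` at the nodes `z 1, …, z k`. -/
def dividedDiff {K : Type*} [Field K] {k : ℕ} (z : Fin k → K) (φ : K → K) : K :=
  ∑ j : Fin k, φ (z j) * (∏ i ∈ Finset.univ.erase j, (z j - z i))⁻¹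


/-- The sum over all words of length `n` obtained by successively removing minimal elements
from `s`, of the products of the inverses of consecutive differences, where the word is
followed by a letter with value `y`. -/
def wordSum {ι K : Type*} [Field K] (r : ι → ι → Prop) (x : ι → K) :
    ℕ → Finset ι → K → K
  | 0, _, _ => 1
  | n + 1, s, y => ∑ a ∈ s.filter (fun a => ∀ b ∈ s, ¬ r b a),
      wordSum r x n (s.erase a) (x a) * (x a - y)⁻¹

lemma wordSum_map {ι κ K : Type*} [Field K] (r : ι → ι → Prop) (x : ι → K) (e : κ ↪ ι)
    (n : ℕ) (s : Finset κ) (y : K) :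
    wordSum r x n (s.map e) y = wordSum (fun a b => r (e a) (e b)) (fun a => x (e a)) n s y := by
  induction n generalizing s y with
  | zero => rfl
  | succ n ih =>
    simp only [wordSum, Finset.sum_filter, Finset.sum_map, Finset.forall_mem_map]
    refine Finset.sum_congr rfl fun a _ => ?_
    rw [← Finset.map_erase, ih]

/-- `f` lists distinct elements of `s`, with larger elements of the order coming first. -/
def IsLinearWord {ι : Type*} (r : ι → ι → Prop) (s : Finset ι) {n : ℕ} (f : Fin n → ι) : Prop :=
  Function.Injective f ∧ (∀ i, f i ∈ s) ∧ ∀ i j, r (f i) (f j) → j < i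

lemma isLinearWord_snoc {ι : Type*} {r : ι → ι → Prop} (hr : ∀ a, ¬ r a a) {s : Finset ι}
    {n : ℕ} (hs : s.card = n + 1) (g : Fin n → ι) (a : ι) :
    IsLinearWord r s (Fin.snoc g a : Fin (n + 1) → ι) ↔
      (a ∈ s ∧ ∀ b ∈ s, ¬ r b a) ∧ IsLinearWord r (s.erase a) g := by
  constructor
  · rintro ⟨hinj, hmem, hlin⟩
    have hsurj : ∀ b ∈ s, ∃ i, (Fin.snoc g a : Fin (n + 1) → ι) i = b := by
      have himg : Finset.univ.image (Fin.snoc g a : Fin (n + 1) → ι) = s := by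
        apply Finset.eq_of_subset_of_card_le
        · intro b hb
          obtain ⟨i, -, rfl⟩ := Finset.mem_image.1 hb
          exact hmem i
        · rw [Finset.card_image_of_injective _ hinj, hs]; simp
      intro b hb
      rw [← himg] at hb
      simpa using hb
    refine ⟨⟨by simpa using hmem (Fin.last n), fun b hb hba => ?_⟩, fun i j hij => ?_,
      fun i => ?_, fun i j hij => ?_⟩
    · obtain ⟨i, rfl⟩ := hsurj b hb
      have := hlin i (Fin.last n) (by simpa using hba)
      exact absurd this (not_lt.2 (Fin.le_last i))
    · exact Fin.castSucc_injective n (hinj (by simpa using hij))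
    · refine Finset.mem_erase.2 ⟨fun h => ?_, by simpa using hmem i.castSucc⟩
      have : i.castSucc = Fin.last n := hinj (by simpa using h)
      exact (Fin.castSucc_lt_last i).ne this
    · exact Fin.castSucc_lt_castSucc_iff.1 (hlin i.castSucc j.castSucc (by simpa using hij))
  · rintro ⟨⟨ha, hmin⟩, hinj, hmem, hlin⟩
    refine ⟨?_, ?_, ?_⟩
    · rw [Fin.snoc_injective_iff]
      refine ⟨hinj, ?_⟩
      rintro ⟨i, hi⟩
      exact (Finset.mem_erase.1 (hmem i)).1 hi
    · intro i
      refine Fin.lastCases ?_ (fun i => ?_) i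
      · simpa using ha
      · simpa using (Finset.mem_erase.1 (hmem i)).2
    · intro i j
      refine Fin.lastCases ?_ (fun i => ?_) i <;> refine Fin.lastCases ?_ (fun j => ?_) j
      · simpa using hr a
      · simp [Fin.castSucc_lt_last]
      · simpa using fun h => absurd h (hmin _ (Finset.mem_erase.1 (hmem i)).2)
      · simpa using hlin i j

/-- The product of the inverses of consecutive differences of the word `v`. -/
def wordWeight {K : Type*} [Field K] {n : ℕ} (v : Fin (n + 1) → K) : K :=
  ∏ i : Fin n, (v i.castSucc - v i.succ)⁻¹

lemma wordWeight_snoc {K : Type*} [Field K] {n : ℕ} (v : Fin (n + 1) → K) (y : K) :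
    wordWeight (Fin.snoc v y : Fin (n + 2) → K) = wordWeight v * (v (Fin.last n) - y)⁻¹ := by
  unfold wordWeight
  rw [Fin.prod_univ_castSucc]
  congr 1
  · refine Finset.prod_congr rfl fun i _ => ?_
    rw [Fin.succ_castSucc, Fin.snoc_castSucc, Fin.snoc_castSucc]
  · rw [Fin.succ_last, Fin.snoc_castSucc, Fin.snoc_last]

lemma comp_snoc_eq {ι K : Type*} (x : ι → K) {n : ℕ} (g : Fin n → ι) (a : ι) :
    (fun i => x ((Fin.snoc g a : Fin (n + 1) → ι) i)) = Fin.snoc (fun i => x (g i)) (x a) := by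
  funext i
  refine Fin.lastCases ?_ (fun i => ?_) i <;> simp

lemma sum_snoc {ι K : Type*} [Fintype ι] [AddCommMonoid K] {n : ℕ}
    (F : (Fin (n + 1) → ι) → K) :
    ∑ f, F f = ∑ a, ∑ g : Fin n → ι, F (Fin.snoc g a) := by
  rw [← Fintype.sum_prod_type']
  exact (Equiv.sum_comp (Fin.snocEquiv fun _ => ι) F).symm

lemma sum_isLinearWord {ι K : Type*} [Fintype ι] [Field K] {r : ι → ι → Prop}
    (hr : ∀ a, ¬ r a a) (x : ι → K) (n : ℕ) (s : Finset ι) (hs : s.card = n) (y : K) :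
    (∑ f : Fin n → ι, if IsLinearWord r s f then
      wordWeight (Fin.snoc (fun i => x (f i)) y : Fin (n + 1) → K) else 0) =
      wordSum r x n s y := by
  induction n generalizing s y with
  | zero => simp [wordSum, wordWeight, IsLinearWord, Function.injective_of_subsingleton]
  | succ n ih =>
    rw [sum_snoc, wordSum, Finset.sum_filter, ← Finset.sum_filter_add_sum_filter_not
      Finset.univ (fun a => a ∈ s)]
    rw [Finset.sum_eq_zero (s := Finset.univ.filter (fun a => a ∉ s)), add_zero]
    · rw [Finset.filter_mem_eq_inter, Finset.univ_inter]
      refine Finset.sum_congr rfl fun a ha => ?_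
      simp only [isLinearWord_snoc hr hs, comp_snoc_eq, wordWeight_snoc, Fin.snoc_last]
      split_ifs with hmin
      · rw [← ih (s.erase a) (by rw [Finset.card_erase_of_mem ha, hs]; rfl), Finset.sum_mul]
        refine Finset.sum_congr rfl fun g _ => ?_
        rw [ite_mul, zero_mul]
        simp only [ha, true_and, and_iff_right hmin]
      · exact Finset.sum_eq_zero fun g _ => if_neg fun h => hmin h.1.2
    · intro a ha
      refine Finset.sum_eq_zero fun g _ => if_neg fun h => ?_
      rw [isLinearWord_snoc hr hs] at h
      exact (Finset.mem_filter.1 ha).2 h.1.1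

lemma sum_perm_eq_sum_isLinearWord {ι K : Type*} [Fintype ι] [AddCommMonoid K]
    (r : ι → ι → Prop) {n : ℕ} (e : Fin n ≃ ι) (F : (Fin n → ι) → K) :
    (∑ α : Equiv.Perm (Fin n),
      if ∀ i j, r (e (α i)) (e (α j)) → j < i then F (fun i => e (α i)) else 0) =
    ∑ f : Fin n → ι, if IsLinearWord r Finset.univ f then F f else 0 := by
  rw [← Finset.sum_filter, ← Finset.sum_filter]
  refine Finset.sum_bij (fun α _ i => e (α i)) ?_ ?_ ?_ ?_
  · intro α hα
    simp only [Finset.mem_filter, Finset.mem_univ, true_and, IsLinearWord] at hα ⊢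
    exact ⟨e.injective.comp α.injective, fun _ => trivial, hα⟩
  · intro α _ β _ h
    ext i
    exact congrArg Fin.val (e.injective (congrFun h i))
  · intro f hf
    simp only [Finset.mem_filter, Finset.mem_univ, true_and, IsLinearWord] at hf
    have hbij : Function.Bijective fun i => e.symm (f i) :=
      Finite.injective_iff_bijective.1 (e.symm.injective.comp hf.1)
    refine ⟨Equiv.ofBijective _ hbij, ?_, ?_⟩
    · simpa using hf.2.2
    · funext i
      simp
  · intro α _
    rfl

lemma sum_perm_eq_wordSum {ι K : Type*} [Fintype ι] [Field K] {r : ι → ι → Prop}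
    (hr : ∀ a, ¬ r a a) (x : ι → K) {t : ι} (ht : ∀ a, a ≠ t → r t a) (hmin : ∀ a, ¬ r a t)
    {n : ℕ} (e : Fin n ≃ ι) :
    (∑ α : Equiv.Perm (Fin n),
      if ∀ i j, r (e (α i)) (e (α j)) → j < i then
        ∏ m : Fin (n - 1), (x (e (α (idxLo m))) - x (e (α (idxHi m))))⁻¹ else 0) =
      wordSum r x (n - 1) (Finset.univ.erase t) (x t) := by
  have hcard : Fintype.card ι = n := by rw [← Fintype.card_congr e, Fintype.card_fin]
  cases n with
  | zero => exact (e.symm t).elim0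
  | succ n =>
    have hcard' : (Finset.univ : Finset ι).card = n + 1 := by rw [Finset.card_univ, hcard]
    refine (sum_perm_eq_sum_isLinearWord r e fun f => wordWeight fun i => x (f i)).trans ?_
    rw [sum_snoc, Finset.sum_eq_single t]
    · rw [Nat.add_sub_cancel, ← sum_isLinearWord hr x n _
        (by rw [Finset.card_erase_of_mem (Finset.mem_univ t), hcard']; rfl)]
      refine Finset.sum_congr rfl fun g _ => ?_
      simp only [isLinearWord_snoc hr hcard', comp_snoc_eq]
      simp [hmin]
    · intro a _ ha
      refine Finset.sum_eq_zero fun g _ => if_neg fun h => ?_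
      rw [isLinearWord_snoc hr hcard'] at h
      exact h.1.2 t (Finset.mem_univ t) (ht a ha)
    · simp

lemma greeneSum_eq_wordSum {ι K : Type*} [Fintype ι] [Field K] {r : ι → ι → Prop}
    (hr : ∀ a, ¬ r a a) (x : ι → K) {t : ι} (ht : ∀ a, a ≠ t → r t a) (hmin : ∀ a, ¬ r a t) :
    greeneSum r x = wordSum r x (Fintype.card ι - 1) (Finset.univ.erase t) (x t) :=
  sum_perm_eq_wordSum hr x ht hmin (Fintype.equivFin ι).symm

lemma greeneSum_adjoinMin {ι K : Type*} [Fintype ι] [Field K] {r : ι → ι → Prop}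
    (hr : ∀ a, ¬ r a a) (x : ι → K) (y : K) :
    greeneSum (adjoinMin r) (extendVar x y) =
      wordSum r x (Fintype.card ι) Finset.univ y := by
  rw [greeneSum_eq_wordSum (t := none)]
  · have h (D : DecidableEq (Option ι)) : @Finset.erase _ D Finset.univ none =
        Finset.univ.map Function.Embedding.some := by
      ext a
      cases a <;> simp
    rw [h, wordSum_map, Fintype.card_option]
    rfl
  · rintro (_ | a)
    · exact id
    · exact hr a
  · rintro (_ | a) h
    · exact absurd rfl h
    · trivial
  · rintro (_ | a) <;> exact id

/-- Lagrange interpolation of `(c - X) ^ n` at `n + 1` nodes, as a partial fraction identity. -/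
lemma sum_pow_mul_inv_prod {ι K : Type*} [Field K] {x : ι → K} (hx : Function.Injective x)
    (C : Finset ι) {n : ℕ} (hC : C.card = n + 1) (c y : K) (hy : ∀ i ∈ C, x i ≠ y) :
    ∑ b ∈ C, (c - x b) ^ n * (∏ i ∈ C.erase b, (x i - x b))⁻¹ * (x b - y)⁻¹ =
      (c - y) ^ n * (∏ i ∈ C, (x i - y))⁻¹ := by
  have hprod : ∏ i ∈ C, (x i - y) ≠ 0 :=
    Finset.prod_ne_zero_iff.2 fun i hi => sub_ne_zero.2 (hy i hi)
  set p : Polynomial K := (Polynomial.C c - Polynomial.X) ^ n with hp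
  have hdeg : p.degree < C.card := by
    have h1 : (Polynomial.C c - Polynomial.X : Polynomial K).degree ≤ 1 := by
      refine (Polynomial.degree_sub_le _ _).trans (max_le ?_ Polynomial.degree_X_le)
      exact Polynomial.degree_C_le.trans zero_le_one
    have h2 : p.degree ≤ (n : WithBot ℕ) := by
      simpa only [mul_one] using Polynomial.degree_pow_le_of_le n h1
    refine h2.trans_lt ?_
    rw [hC]
    exact_mod_cast Nat.lt_succ_self n
  have hint := congrArg (Polynomial.eval y)
    (Lagrange.eq_interpolate (s := C) (v := x) hx.injOn hdeg)
  rw [Lagrange.interpolate_apply, Polynomial.eval_finsetSum] at hint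
  have hpe : ∀ w, Polynomial.eval w p = (c - w) ^ n := by intro w; simp [hp]
  rw [← hpe y, hint, Finset.sum_mul]
  refine Finset.sum_congr rfl fun b hb => ?_
  have hby : x b - y ≠ 0 := sub_ne_zero.2 (hy b hb)
  have hbasis : Polynomial.eval y (Lagrange.basis C x b) =
      (∏ i ∈ C.erase b, (x i - x b))⁻¹ * ∏ i ∈ C.erase b, (x i - y) := by
    rw [Lagrange.basis, Polynomial.eval_prod, ← Finset.prod_inv_distrib,
      ← Finset.prod_mul_distrib]
    refine Finset.prod_congr rfl fun i hi => ?_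
    simp only [Lagrange.basisDivisor, Polynomial.eval_mul, Polynomial.eval_C,
      Polynomial.eval_sub, Polynomial.eval_X]
    rw [← neg_sub (x i) (x b), ← neg_sub (x i) y, inv_neg, neg_mul_neg]
  rw [Polynomial.eval_mul, Polynomial.eval_C, hpe, hbasis, ← Finset.mul_prod_erase C _ hb]
  have hprod' : ∏ i ∈ C.erase b, (x i - y) ≠ 0 :=
    Finset.prod_ne_zero_iff.2 fun i hi => sub_ne_zero.2 (hy i (Finset.mem_of_mem_erase hi))
  rw [mul_inv]
  field_simp

lemma erase_union_of_above {ι : Type*} {r : ι → ι → Prop} {U B : Finset ι}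
    (habove : ∀ a ∈ B, ∀ u ∈ U, r a u ∧ ¬ r u a) {b : ι} (hb : b ∈ B) :
    (U ∪ B).erase b = U ∪ B.erase b := by
  rw [Finset.erase_union_distrib, Finset.erase_eq_of_notMem fun hbU =>
    (habove b hb b hbU).2 (habove b hb b hbU).1]

lemma filter_minimal_union {ι : Type*} {r : ι → ι → Prop} {U B : Finset ι} (hB : B.Nonempty)
    (hanti : ∀ a ∈ B, ∀ b ∈ B, ¬ r a b)
    (habove : ∀ a ∈ B, ∀ u ∈ U, r a u ∧ ¬ r u a) :
    (U ∪ B).filter (fun a => ∀ b ∈ U ∪ B, ¬ r b a) = B := by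
  ext a
  simp only [Finset.mem_filter, Finset.mem_union]
  constructor
  · rintro ⟨ha | ha, h⟩
    · obtain ⟨b, hb⟩ := hB
      exact absurd (habove b hb a ha).1 (h b (Or.inr hb))
    · exact ha
  · intro ha
    refine ⟨Or.inr ha, ?_⟩
    rintro b (hb | hb)
    · exact (habove a ha b hb).2
    · exact hanti b hb a ha

lemma wordSum_union_antichain {ι K : Type*} [Field K] {r : ι → ι → Prop}
    {x : ι → K} (hx : Function.Injective x) (U : Finset ι) (n : ℕ) (B : Finset ι)
    (hB : B.card = n + 1) (hanti : ∀ a ∈ B, ∀ b ∈ B, ¬ r a b)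
    (habove : ∀ a ∈ B, ∀ u ∈ U, r a u ∧ ¬ r u a) (y : K) (hy : ∀ i ∈ B, x i ≠ y) :
    wordSum r x (U.card + (n + 1)) (U ∪ B) y =
      ∑ j ∈ B, wordSum r x U.card U (x j) *
        ((x j - y) ^ n * (∏ i ∈ B.erase j, (x j - x i))⁻¹ * (∏ i ∈ B, (x i - y))⁻¹) := by
  induction n generalizing B y with
  | zero =>
    obtain ⟨b, rfl⟩ := Finset.card_eq_one.1 hB
    rw [zero_add, wordSum, filter_minimal_union ⟨b, by simp⟩ hanti habove]
    rw [Finset.sum_singleton, erase_union_of_above habove (by simp)]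
    simp
  | succ n ih =>
    have hstep : ∀ b ∈ B, wordSum r x (U.card + (n + 1)) ((U ∪ B).erase b) (x b) =
        ∑ j ∈ B.erase b, wordSum r x U.card U (x j) * ((x j - x b) ^ n *
          (∏ i ∈ (B.erase b).erase j, (x j - x i))⁻¹ *
          (∏ i ∈ B.erase b, (x i - x b))⁻¹) := by
      intro b hb
      rw [erase_union_of_above habove hb]
      exact ih (B.erase b) (by rw [Finset.card_erase_of_mem hb, hB]; rfl)
        (fun a ha c hc => hanti a (Finset.mem_of_mem_erase ha) c (Finset.mem_of_mem_erase hc))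
        (fun a ha => habove a (Finset.mem_of_mem_erase ha)) (x b)
        fun i hi => hx.ne (Finset.ne_of_mem_erase hi)
    rw [← add_assoc, wordSum,
      filter_minimal_union (Finset.card_pos.1 (by omega)) hanti habove,
      Finset.sum_congr rfl fun b hb => by rw [hstep b hb]]
    simp only [Finset.sum_mul]
    rw [Finset.sum_comm' (t' := B) (s' := fun j => B.erase j)
      (fun b j => by simp only [Finset.mem_erase]; tauto)]
    refine Finset.sum_congr rfl fun j hj => ?_
    have hjy : x j - y ≠ 0 := sub_ne_zero.2 (hy j hj)
    have hCcard : (B.erase j).card = n + 1 := by rw [Finset.card_erase_of_mem hj, hB]; rfl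
    have hlag := sum_pow_mul_inv_prod hx (B.erase j) hCcard (x j) y
      fun i hi => hy i (Finset.mem_of_mem_erase hi)
    rw [← Finset.mul_prod_erase B _ hj]
    have hrhs : (x j - y) ^ (n + 1) * (∏ i ∈ B.erase j, (x j - x i))⁻¹ *
        ((x j - y) * ∏ i ∈ B.erase j, (x i - y))⁻¹ =
        (∏ i ∈ B.erase j, (x j - x i))⁻¹ *
          ((x j - y) ^ n * (∏ i ∈ B.erase j, (x i - y))⁻¹) := by
      rw [mul_inv, pow_succ]
      field_simp
    rw [hrhs, ← hlag, Finset.mul_sum, Finset.mul_sum]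
    refine Finset.sum_congr rfl fun b hb => ?_
    obtain ⟨hbj, hbB⟩ := Finset.mem_erase.1 hb
    have hjb : x j - x b ≠ 0 := sub_ne_zero.2 (hx.ne hbj.symm)
    rw [Finset.erase_right_comm,
      ← Finset.mul_prod_erase (B.erase b) (fun i => x i - x b)
        (Finset.mem_erase.2 ⟨hbj.symm, hj⟩),
      ← Finset.mul_prod_erase (B.erase j) (fun i => x j - x i) hb,
      Finset.erase_right_comm (s := B) (a := b), mul_inv, mul_inv]
    ring

/-- If `Z_k` is a separating subset of `P` with `P^≺ = {t}` a single
element, then `G(P) = −Δ_{Z_k}[(t−z)^{k−1} G(P^≻ ∪ z)]/h(t)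
= −Σ_j (t−z_j)^{k−1} G(P^≻ ∪ z_j)/(h(t) h'(z_j))`. -/
theorem greeneSum_separating_below_singleton
    {ι : Type*} [Fintype ι] {K : Type*} [Field K] [CharZero K]
    (r : ι → ι → Prop) (hr : IsStrictOrder ι r)
    (x : ι → K) (hx : Function.Injective x)
    {k : ℕ} (hk : 0 < k) (z : Fin k → ι) (hz : Function.Injective z)
    (hsep : IsSeparating r (Set.range z))
    (t : ι) (hprec : below r (Set.range z) = {t}) :
    greeneSum r x =
      - dividedDiff (fun j => x (z j))
          (fun w => (x t - w) ^ (k - 1) *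
            greeneSum (adjoinMin (fun a b : ↥(above r (Set.range z)) => r a.1 b.1))
              (extendVar (fun a : ↥(above r (Set.range z)) => x a.1) w)) /
        (∏ i : Fin k, (x t - x (z i))) ∧
    greeneSum r x =
      - ∑ j : Fin k,
          (x t - x (z j)) ^ (k - 1) *
            greeneSum (adjoinMin (fun a b : ↥(above r (Set.range z)) => r a.1 b.1))
              (extendVar (fun a : ↥(above r (Set.range z)) => x a.1) (x (z j))) *
            ((∏ i : Fin k, (x t - x (z i))) *
              ∏ i ∈ Finset.univ.erase j, (x (z j) - x (z i)))⁻¹ := by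
  have hirr : ∀ a, ¬ r a a := hr.irrefl
  have htrans : ∀ a b c, r a b → r b c → r a c := hr.trans
  set U : Finset ι := (above r (Set.range z)).toFinset with hU
  set B : Finset ι := Finset.univ.image z with hB
  have hmemU : ∀ u, u ∈ U ↔ ∀ i, r (z i) u := by
    intro u
    rw [hU, Set.mem_toFinset]
    simp [above]
  have hmemB : ∀ b, b ∈ B ↔ ∃ i, z i = b := by intro b; simp [hB]
  have hbelow : ∀ u, (∀ i, r u (z i)) ↔ u = t := by
    intro u
    rw [← Set.mem_singleton_iff, ← hprec]
    simp [below]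
  have htz : ∀ i, r t (z i) := (hbelow t).2 rfl
  have hcases : ∀ u, u ≠ t → u ∉ B → u ∈ U := by
    intro u hut huB
    rcases hsep.2 u (fun h => huB ((hmemB u).2 h)) with h | h
    · exact absurd ((hbelow u).1 fun i => h _ ⟨i, rfl⟩) hut
    · exact (hmemU u).2 fun i => h _ ⟨i, rfl⟩
  have hmint : ∀ a, a ≠ t → r t a := by
    intro a ha
    by_cases haB : a ∈ B
    · obtain ⟨i, rfl⟩ := (hmemB a).1 haB
      exact htz i
    · exact htrans _ _ _ (htz ⟨0, hk⟩) ((hmemU a).1 (hcases a ha haB) ⟨0, hk⟩)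
  have hmin : ∀ a, ¬ r a t := by
    intro a hat
    by_cases ha : a = t
    · exact hirr t (ha ▸ hat)
    · exact hirr t (htrans _ _ _ (hmint a ha) hat)
  have hasymm : ∀ a b, r a b → ¬ r b a := fun a b hab hba => hirr a (htrans _ _ _ hab hba)
  have hanti : ∀ a ∈ B, ∀ b ∈ B, ¬ r a b := by
    intro a ha b hb hab
    have hne : a ≠ b := fun h => hirr b (h ▸ hab)
    exact (hsep.1 a ((hmemB a).1 ha) b ((hmemB b).1 hb) hne).1 hab
  have habove : ∀ a ∈ B, ∀ u ∈ U, r a u ∧ ¬ r u a := by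
    intro a ha u hu
    obtain ⟨i, rfl⟩ := (hmemB a).1 ha
    exact ⟨(hmemU u).1 hu i, hasymm _ _ ((hmemU u).1 hu i)⟩
  have hunion : Finset.univ.erase t = U ∪ B := by
    ext u
    simp only [Finset.mem_erase, Finset.mem_univ, and_true, Finset.mem_union]
    constructor
    · intro hut
      by_cases huB : u ∈ B
      · exact Or.inr huB
      · exact Or.inl (hcases u hut huB)
    · rintro h rfl
      rcases h with h | h
      · exact hmin _ ((hmemU _).1 h ⟨0, hk⟩)
      · obtain ⟨i, hi⟩ := (hmemB _).1 h
        exact hirr u (by simpa only [hi] using htz i)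
  have hBcard : B.card = k := by
    rw [hB, Finset.card_image_of_injective _ hz, Finset.card_univ, Fintype.card_fin]
  have hcard : Fintype.card ι - 1 = U.card + k := by
    rw [← Finset.card_univ, ← Finset.card_erase_of_mem (Finset.mem_univ t), hunion,
      Finset.card_union_of_disjoint, hBcard]
    exact Finset.disjoint_left.2 fun u hu hb => (habove u hb u hu).2 (habove u hb u hu).1
  obtain ⟨n, rfl⟩ : ∃ n, k = n + 1 := ⟨k - 1, by omega⟩
  have hG : ∀ y, greeneSum (adjoinMin (fun a b : ↥(above r (Set.range z)) => r a.1 b.1))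
      (extendVar (fun a : ↥(above r (Set.range z)) => x a.1) y) =
      wordSum r x U.card U y := by
    intro y
    rw [greeneSum_adjoinMin fun a => hirr a.1]
    have hmap : U = Finset.univ.map (Function.Embedding.subtype (· ∈ above r (Set.range z))) := by
      ext u
      simp [hU]
    rw [hU, Set.toFinset_card, ← hU, hmap, wordSum_map]
    rfl
  have hmain : greeneSum r x =
      - ∑ j : Fin (n + 1),
          (x t - x (z j)) ^ (n + 1 - 1) *
            greeneSum (adjoinMin (fun a b : ↥(above r (Set.range z)) => r a.1 b.1))
              (extendVar (fun a : ↥(above r (Set.range z)) => x a.1) (x (z j))) *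
            ((∏ i : Fin (n + 1), (x t - x (z i))) *
              ∏ i ∈ Finset.univ.erase j, (x (z j) - x (z i)))⁻¹ := by
    have hzt : ∀ i ∈ B, x i ≠ x t := by
      intro i hi
      obtain ⟨j, rfl⟩ := (hmemB i).1 hi
      exact hx.ne fun h => hirr t (by simpa only [h] using htz j)
    rw [greeneSum_eq_wordSum hirr x hmint hmin, hunion, hcard,
      wordSum_union_antichain hx U n B hBcard hanti habove (x t) hzt, hB,
      Finset.sum_image hz.injOn, ← Finset.sum_neg_distrib]
    refine Finset.sum_congr rfl fun j _ => ?_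
    have hprod : ∏ i : Fin (n + 1), (x (z i) - x t) =
        (-1) ^ (n + 1) * ∏ i : Fin (n + 1), (x t - x (z i)) := by
      simp_rw [← neg_sub (x t), Finset.prod_neg]
      simp
    rw [hG, ← Finset.image_erase hz, Finset.prod_image hz.injOn, Finset.prod_image hz.injOn,
      hprod, ← neg_sub (x t) (x (z j)), neg_pow, Nat.add_sub_cancel, mul_inv, mul_inv,
      ← inv_pow, inv_neg_one, pow_succ (-1 : K) n]
    have hsq : ((-1 : K) ^ n) * (-1) ^ n = 1 := by rw [← mul_pow]; simp
    linear_combination (-(wordSum r x U.card U (x (z j)) * (x t - x (z j)) ^ n *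
      (∏ i : Fin (n + 1), (x t - x (z i)))⁻¹ *
      (∏ i ∈ Finset.univ.erase j, (x (z j) - x (z i)))⁻¹)) * hsq
  refine ⟨?_, hmain⟩
  rw [hmain, dividedDiff, neg_div, Finset.sum_div]
  congr 1
  refine Finset.sum_congr rfl fun j _ => ?_
  rw [mul_inv, div_eq_mul_inv]
  ring

end
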